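/- Let (X,Π) be a two-sided γ-local-spectral expander and f ∈ C_k an (ε,i)-pseudorandom function satisfying E[f] ≤ ε‖f‖_∞. Then the i-th Bottom-Up level function has small infinity norm: ‖g_i‖_∞ ≤ 2^i·ε·‖f‖_∞. -/

import Mathlib

open Finset

/-- Functions on faces of a complex on vertex set `Fin n`. -/
abbrev Cf (n : ℕ) := Finset (Fin n) → ℝ

/-- A `d`-dimensional weighted pure simplicial complex on vertex set `Fin n`:
the downward closure of a `d`-uniform hypergraph `faces d`, together with a
probability distribution on the top faces inducing distributions `w i` on each
level `faces i` via `π_i(x) = (1/(i+1))·Σ_{y ⊃ x} π_{i+1}(y)`. -/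
structure WSC (n d : ℕ) where
  faces : ℕ → Finset (Finset (Fin n))
  top_nonempty : (faces d).Nonempty
  card_mem : ∀ i, ∀ s ∈ faces i, s.card = i
  empty_levels : ∀ i, d < i → faces i = ∅
  downward : ∀ i, i < d → ∀ s : Finset (Fin n),
    s ∈ faces i ↔ (s.card = i ∧ ∃ t ∈ faces (i+1), s ⊆ t)
  w : ℕ → Finset (Fin n) → ℝ
  w_nonneg : ∀ i s, 0 ≤ w i s
  w_pos : ∀ i, ∀ s ∈ faces i, 0 < w i s
  w_zero : ∀ i s, s ∉ faces i → w i s = 0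
  w_top_sum : ∑ s ∈ faces d, w d s = 1
  w_rec : ∀ i, i < d → ∀ s ∈ faces i,
    w i s = (1/(i+1 : ℝ)) * ∑ t ∈ (faces (i+1)).filter (fun t => s ⊆ t), w (i+1) t

variable {n d : ℕ}

/-- The up operator `U_k : C_k → C_{k+1}`. -/
noncomputable def Uop (X : WSC n d) (k : ℕ) (f : Cf n) : Cf n := fun τ =>
  (1/(k+1 : ℝ)) * ∑ σ ∈ (X.faces k).filter (fun σ => σ ⊆ τ), f σ

/-- The down operator `D_{k+1} : C_{k+1} → C_k`. -/
noncomputable def Dop (X : WSC n d) (k : ℕ) (f : Cf n) : Cf n := fun τ =>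
  (∑ σ ∈ (X.faces (k+1)).filter (fun σ => τ ⊆ σ), X.w (k+1) σ * f σ) /
  (∑ σ ∈ (X.faces (k+1)).filter (fun σ => τ ⊆ σ), X.w (k+1) σ)

/-- `Uc X i m : C_i → C_{i+m}` is the iterated up operator; `U_i^k = Uc X i (k-i)`. -/
noncomputable def Uc (X : WSC n d) (i : ℕ) : ℕ → Cf n → Cf n
  | 0, f => f
  | m+1, f => Uop X (i+m) (Uc X i m f)

/-- `Dc X k m : C_k → C_{k-m}` is the iterated down operator; `D_i^k = Dc X k (k-i)`. -/
noncomputable def Dc (X : WSC n d) (k : ℕ) : ℕ → Cf n → Cf n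
  | 0, f => f
  | m+1, f => Dop X (k - (m+1)) (Dc X k m f)

/-- Bottom-Up level functions: `g_i = D_i^k f − Σ_{j<i} C(i,j)·U_j^i g_j ∈ C_i`. -/
noncomputable def gLevel (X : WSC n d) (k : ℕ) (f : Cf n) : ℕ → Cf n
  | i => Dc X k (k - i) f - ∑ j ∈ (Finset.range i).attach,
      ((i.choose j.1 : ℝ)) • Uc X j.1 (i - j.1) (gLevel X k f j.1)
  termination_by i => i
  decreasing_by exact Finset.mem_range.mp j.2

/-- Lifted Bottom-Up level functions: `f_i^↑ = C(k,i)·U_i^k g_i ∈ C_k`. -/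
noncomputable def fLevel (X : WSC n d) (k : ℕ) (f : Cf n) (i : ℕ) : Cf n :=
  ((k.choose i : ℝ)) • Uc X i (k - i) (gLevel X k f i)

/-- Inner product at level `i`: `⟨f,g⟩ = E_{τ∼π_i}[f(τ)g(τ)]`. -/
noncomputable def ip (X : WSC n d) (i : ℕ) (f g : Cf n) : ℝ :=
  ∑ τ ∈ X.faces i, X.w i τ * f τ * g τ

/-- Expectation at level `i`. -/
noncomputable def EE (X : WSC n d) (i : ℕ) (f : Cf n) : ℝ :=
  ∑ τ ∈ X.faces i, X.w i τ * f τ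

/-- `L²` norm at level `i`. -/
noncomputable def norm2 (X : WSC n d) (i : ℕ) (f : Cf n) : ℝ := Real.sqrt (ip X i f f)

/-- `L^p` norm at level `i`. -/
noncomputable def normP (X : WSC n d) (i : ℕ) (p : ℝ) (f : Cf n) : ℝ :=
  (∑ τ ∈ X.faces i, X.w i τ * |f τ| ^ p) ^ (1/p)

/-- `L^∞` norm at level `i` : the maximum of `|f|` over `i`-faces. -/
noncomputable def normInf (X : WSC n d) (i : ℕ) (f : Cf n) : ℝ :=
  ⨆ τ : {σ // σ ∈ X.faces i}, |f τ.1|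

/-- `E_{X_τ}[f|_τ]`: the weighted mean of `f ∈ C_k` over `k`-faces containing `τ`. -/
noncomputable def linkMean (X : WSC n d) (k : ℕ) (τ : Finset (Fin n)) (f : Cf n) : ℝ :=
  (∑ ρ ∈ (X.faces k).filter (fun ρ => τ ⊆ ρ), X.w k ρ * f ρ) /
  (∑ ρ ∈ (X.faces k).filter (fun ρ => τ ⊆ ρ), X.w k ρ)

/-- `⟨f|_τ, g|_τ⟩` over the link `X_τ` with its induced distribution, for `f, g ∈ C_k`. -/
noncomputable def linkIp (X : WSC n d) (k : ℕ) (τ : Finset (Fin n)) (f g : Cf n) : ℝ :=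
  (∑ ρ ∈ (X.faces k).filter (fun ρ => τ ⊆ ρ), X.w k ρ * f ρ * g ρ) /
  (∑ ρ ∈ (X.faces k).filter (fun ρ => τ ⊆ ρ), X.w k ρ)

/-- `f ∈ C_k` is `(ε,i)`-pseudorandom: `|E_{X_τ}[f|_τ]| ≤ ε‖f‖_∞` and
`⟨f|_τ,f|_τ⟩ ≤ ε‖f‖_∞²` for every `i`-face `τ`. -/
def Pseudorandom (X : WSC n d) (k : ℕ) (ε : ℝ) (i : ℕ) (f : Cf n) : Prop :=
  ∀ τ ∈ X.faces i, |linkMean X k τ f| ≤ ε * normInf X k f ∧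
    linkIp X k τ f f ≤ ε * (normInf X k f)^2

/-- Boolean ({0,1}-valued) function on `X(k)`. -/
def IsBool (X : WSC n d) (k : ℕ) (f : Cf n) : Prop := ∀ τ ∈ X.faces k, f τ = 0 ∨ f τ = 1

/-- Total influence `I[f] = ⟨f, k(Id − U_{k−1}D_k) f⟩`. -/
noncomputable def influence (X : WSC n d) (k : ℕ) (f : Cf n) : ℝ :=
  (k : ℝ) * (ip X k f f - ip X k f (Uop X (k-1) (Dop X (k-1) f)))

/-- Variance `Var(f) = E[f²] − E[f]²`. -/
noncomputable def variance (X : WSC n d) (k : ℕ) (f : Cf n) : ℝ :=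
  ip X k f f - (EE X k f)^2

/-- The noise operator `T_ρ = Σ_{i=0}^k C(k,i)(1−ρ)^i ρ^{k−i} U_{k−i}^k D_{k−i}^k`. -/
noncomputable def noiseOp (X : WSC n d) (k : ℕ) (ρ : ℝ) (f : Cf n) : Cf n :=
  ∑ i ∈ Finset.range (k+1),
    ((k.choose i : ℝ) * (1-ρ)^i * ρ^(k-i)) • Uc X (k-i) i (Dc X k i f)

/-- Noise stability `Stab_ρ(f) = ⟨f, T_ρ f⟩`. -/
noncomputable def stab (X : WSC n d) (k : ℕ) (ρ : ℝ) (f : Cf n) : ℝ :=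
  ip X k f (noiseOp X k ρ f)

/-- Edge weights of the underlying graph of the link of `s ∈ X(i)`. -/
noncomputable def edgeW (X : WSC n d) (i : ℕ) (s : Finset (Fin n)) (u v : Fin n) : ℝ :=
  if u ≠ v ∧ u ∉ s ∧ v ∉ s ∧ insert u (insert v s) ∈ X.faces (i+2)
  then X.w (i+2) (insert u (insert v s)) else 0

/-- Vertex weights of the underlying graph of the link of `s ∈ X(i)`. -/
noncomputable def vertW (X : WSC n d) (i : ℕ) (s : Finset (Fin n)) (u : Fin n) : ℝ :=
  ∑ v, edgeW X i s u v

/-- `X` is a two-sided `γ`-local-spectral expander: for every `i ≤ d−2` and every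
`s ∈ X(i)` (including `s = ∅`), every nontrivial eigenvalue of the weighted adjacency
operator of the graph `(X_s(1), X_s(2))` has absolute value at most `γ`, expressed via
the quadratic form on functions orthogonal to constants. -/
def IsLSE (X : WSC n d) (γ : ℝ) : Prop :=
  ∀ i, i + 2 ≤ d → ∀ s ∈ X.faces i, ∀ f : Fin n → ℝ,
    (∑ u, vertW X i s u * f u) = 0 →
    |∑ u, ∑ v, edgeW X i s u v * f u * f v| ≤ γ * ∑ u, vertW X i s u * (f u)^2

/-- The swap walk `S_{j,i} : C_i → C_j`: `(S_{j,i} f)(τ)` is the weighted mean of `f(σ)`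
over `i`-faces `σ` disjoint from `τ` with `τ ∪ σ ∈ X(i+j)`. -/
noncomputable def swapW (X : WSC n d) (j i : ℕ) (f : Cf n) : Cf n := fun τ =>
  (∑ σ ∈ (X.faces i).filter (fun σ => Disjoint σ τ ∧ σ ∪ τ ∈ X.faces (i+j)),
      X.w (i+j) (σ ∪ τ) * f σ) /
  (∑ σ ∈ (X.faces i).filter (fun σ => Disjoint σ τ ∧ σ ∪ τ ∈ X.faces (i+j)),
      X.w (i+j) (σ ∪ τ))

/-- Localized mean: `E_{σ ∼ π_{v,i}}[f(σ)]`, the mean of `f ∈ C_i` over the `i`-faces of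
the link `X_v` of `v ∈ X(j)`, with respect to the distribution induced by the link. -/
noncomputable def locMean (X : WSC n d) (i j : ℕ) (v : Finset (Fin n)) (f : Cf n) : ℝ :=
  (∑ σ ∈ (X.faces i).filter (fun σ => Disjoint σ v ∧ σ ∪ v ∈ X.faces (i+j)),
      X.w (i+j) (σ ∪ v) * f σ) /
  (∑ σ ∈ (X.faces i).filter (fun σ => Disjoint σ v ∧ σ ∪ v ∈ X.faces (i+j)),
      X.w (i+j) (σ ∪ v))

/-- The `m`-faces of the link `X_τ`. -/
noncomputable def lkFaces (X : WSC n d) (τ : Finset (Fin n)) (m : ℕ) : Finset (Finset (Fin n)) :=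
  (Finset.univ : Finset (Finset (Fin n))).filter
    (fun σ => Disjoint σ τ ∧ σ ∪ τ ∈ X.faces (τ.card + m))

/-- Inner product at level `m` of the link `X_τ` (with the induced distribution). -/
noncomputable def lkIp (X : WSC n d) (τ : Finset (Fin n)) (m : ℕ) (f g : Cf n) : ℝ :=
  (∑ σ ∈ lkFaces X τ m, X.w (τ.card + m) (σ ∪ τ) * f σ * g σ) /
  (∑ σ ∈ lkFaces X τ m, X.w (τ.card + m) (σ ∪ τ))

/-- `L²` norm at level `m` of the link `X_τ`. -/
noncomputable def lkNorm2 (X : WSC n d) (τ : Finset (Fin n)) (m : ℕ) (f : Cf n) : ℝ :=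
  Real.sqrt (lkIp X τ m f f)

/-- Global mean at level `m` of the link `X_τ` (the stationary operator `U_0^j D_0^m`
of the swap walk on `X_τ` applied to `f`). -/
noncomputable def lkMeanLvl (X : WSC n d) (τ : Finset (Fin n)) (m : ℕ) (f : Cf n) : ℝ :=
  (∑ σ ∈ lkFaces X τ m, X.w (τ.card + m) (σ ∪ τ) * f σ) /
  (∑ σ ∈ lkFaces X τ m, X.w (τ.card + m) (σ ∪ τ))

/-- The swap walk `S_{j,m}` within the link `X_τ`. -/
noncomputable def lkSwap (X : WSC n d) (τ : Finset (Fin n)) (j m : ℕ) (f : Cf n) : Cf n := fun v =>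
  (∑ σ ∈ (lkFaces X τ m).filter (fun σ => Disjoint σ v ∧ σ ∪ v ∈ lkFaces X τ (m+j)),
      X.w (τ.card + m + j) (σ ∪ v ∪ τ) * f σ) /
  (∑ σ ∈ (lkFaces X τ m).filter (fun σ => Disjoint σ v ∧ σ ∪ v ∈ lkFaces X τ (m+j)),
      X.w (τ.card + m + j) (σ ∪ v ∪ τ))

/-- Restriction `f|_τ(σ) = f(τ ∪ σ)`. -/
def restrictF (τ : Finset (Fin n)) (f : Cf n) : Cf n := fun σ => f (τ ∪ σ)

/-- The Bottom-Up level function of the restriction `f|_υ` computed within the link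
`X_υ` (via its explicit form): `g_ℓ^{(υ)}(I) = Σ_{T ⊆ I} (−1)^{|I∖T|}·E_{(X_υ)_T}[f|_υ]`. -/
noncomputable def gLink (X : WSC n d) (k : ℕ) (f : Cf n) (υ : Finset (Fin n)) : Cf n :=
  fun I => ∑ σ ∈ I.powerset, (-1:ℝ)^((I \ σ).card) * linkMean X k (υ ∪ σ) f

/-- A subset of a face is a face. -/
lemma WSC.mem_faces_of_subset (X : WSC n d) {i j : ℕ} {s t : Finset (Fin n)}
    (ht : t ∈ X.faces i) (hst : s ⊆ t) (hs : s.card = j) : s ∈ X.faces j := by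
  obtain ⟨m, hm⟩ : ∃ m, i = j + m :=
    Nat.exists_eq_add_of_le (by rw [← hs, ← X.card_mem i t ht]; exact card_le_card hst)
  induction m generalizing j s with
  | zero =>
    have hts : s = t := eq_of_subset_of_card_le hst (by rw [X.card_mem i t ht]; omega)
    subst hts hm
    exact ht
  | succ m ih =>
    have hi : i ≤ d := by
      by_contra h
      simp [X.empty_levels i (by omega)] at ht
    have hcard := X.card_mem i t ht
    obtain ⟨a, hat, has⟩ := exists_mem_notMem_of_card_lt_card (s := s) (t := t) (by omega)
    have hmem : insert a s ∈ X.faces (j + 1) :=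
      ih (insert_subset hat hst) (by rw [card_insert_of_notMem has, hs]) (by omega)
    exact (X.downward j (by omega) s).2 ⟨hs, _, hmem, subset_insert a s⟩

lemma WSC.filter_subset_eq_powersetCard (X : WSC n d) {i j : ℕ} {t : Finset (Fin n)}
    (ht : t ∈ X.faces i) : (X.faces j).filter (fun s => s ⊆ t) = t.powersetCard j := by
  ext s
  simp only [mem_filter, mem_powersetCard]
  exact ⟨fun h => ⟨h.2, X.card_mem j s h.1⟩, fun h => ⟨X.mem_faces_of_subset ht h.1 h.2, h.1⟩⟩

/-- Sets lying one element above `s` and inside `t`. -/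
lemma card_filter_subset_powersetCard_succ {α : Type*} [DecidableEq α] {s t : Finset α}
    (hst : s ⊆ t) :
    ((t.powersetCard (s.card + 1)).filter (fun u => s ⊆ u)).card = t.card - s.card := by
  rw [← card_sdiff_of_subset hst]
  symm
  refine card_bij (fun a _ => insert a s) ?_ ?_ ?_
  · intro a ha
    rw [mem_sdiff] at ha
    simp [mem_powersetCard, insert_subset ha.1 hst, card_insert_of_notMem ha.2]
  · intro a ha b hb hab
    rw [mem_sdiff] at ha hb
    have : a ∈ insert b s := hab ▸ mem_insert_self a s
    exact (mem_insert.1 this).resolve_right ha.2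
  · intro u hu
    simp only [mem_filter, mem_powersetCard] at hu
    obtain ⟨a, ha⟩ := card_eq_one.1
      (show (u \ s).card = 1 by rw [card_sdiff_of_subset hu.2]; omega)
    have hau : a ∈ u \ s := ha ▸ mem_singleton_self a
    rw [mem_sdiff] at hau
    refine ⟨a, mem_sdiff.2 ⟨hu.1.1 hau.1, hau.2⟩, ?_⟩
    rw [insert_eq, ← ha, sdiff_union_of_subset hu.2]

/-- Sets lying one element below `t` and containing `s`. -/
lemma card_filter_subset_powersetCard_pred {α : Type*} [DecidableEq α] {s t : Finset α} {m : ℕ}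
    (hst : s ⊆ t) (ht : t.card = m + 1) :
    ((t.powersetCard m).filter (fun u => s ⊆ u)).card = t.card - s.card := by
  rw [← card_sdiff_of_subset hst]
  symm
  refine card_bij (fun a _ => t.erase a) ?_ ?_ ?_
  · intro a ha
    rw [mem_sdiff] at ha
    simp [mem_powersetCard, erase_subset, card_erase_of_mem ha.1, ht, subset_erase, hst, ha.2]
  · intro a ha b hb hab
    rw [mem_sdiff] at ha hb
    exact (erase_inj t ha.1).1 hab
  · intro u hu
    simp only [mem_filter, mem_powersetCard] at hu
    obtain ⟨a, ha⟩ := card_eq_one.1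
      (show (t \ u).card = 1 by rw [card_sdiff_of_subset hu.1.1]; omega)
    have hat : a ∈ t \ u := ha ▸ mem_singleton_self a
    rw [mem_sdiff] at hat
    refine ⟨a, mem_sdiff.2 ⟨hat.1, fun h => hat.2 (hu.2 h)⟩, ?_⟩
    rw [erase_eq, ← ha, Finset.sdiff_sdiff_eq_self hu.1.1]

/-- The iterated up operator averages over sub-faces. -/
lemma choose_mul_Uc (X : WSC n d) (j m : ℕ) (g : Cf n) {τ : Finset (Fin n)}
    (hτ : τ ∈ X.faces (j + m)) :
    ((j + m).choose j : ℝ) * Uc X j m g τ = ∑ σ ∈ τ.powersetCard j, g σ := by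
  induction m generalizing τ with
  | zero =>
    have h : τ.powersetCard j = {τ} := by
      have hcard : τ.card = j := X.card_mem _ τ hτ
      rw [← hcard, powersetCard_self]
    simp [Uc, h]
  | succ m ih =>
    have hcard : τ.card = j + m + 1 := X.card_mem _ τ hτ
    have hdouble : ∑ σ ∈ τ.powersetCard (j + m), ∑ ρ ∈ σ.powersetCard j, g ρ
        = (m + 1 : ℝ) * ∑ ρ ∈ τ.powersetCard j, g ρ := by
      rw [sum_comm' (t' := τ.powersetCard j)
        (s' := fun ρ => (τ.powersetCard (j + m)).filter (fun σ => ρ ⊆ σ)), mul_sum]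
      · refine sum_congr rfl fun ρ hρ => ?_
        rw [mem_powersetCard] at hρ
        rw [sum_const, card_filter_subset_powersetCard_pred hρ.1 hcard, hcard, hρ.2, nsmul_eq_mul,
          show j + m + 1 - j = m + 1 by omega]
        push_cast
        ring
      · intro σ ρ
        simp only [mem_powersetCard, mem_filter]
        exact ⟨fun h => ⟨⟨h.1, h.2.1⟩, h.2.1.trans h.1.1, h.2.2⟩,
          fun h => ⟨h.1.1, h.1.2, h.2.2⟩⟩
    have hsum : ((j + m).choose j : ℝ) * ∑ σ ∈ τ.powersetCard (j + m), Uc X j m g σ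
        = (m + 1 : ℝ) * ∑ ρ ∈ τ.powersetCard j, g ρ := by
      rw [← hdouble, mul_sum]
      refine sum_congr rfl fun σ hσ => ?_
      rw [mem_powersetCard] at hσ
      exact ih (X.mem_faces_of_subset hτ hσ.1 hσ.2)
    have hchoose : ((j + (m + 1)).choose j : ℝ) * (m + 1) = (j + m + 1) * (j + m).choose j := by
      have h := Nat.choose_mul_succ_eq (j + m) j
      rw [show j + m + 1 - j = m + 1 by omega] at h
      have h' : (((j + m).choose j * (j + m + 1) : ℕ) : ℝ)
          = (((j + m + 1).choose j * (m + 1) : ℕ) : ℝ) := congrArg _ h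
      push_cast at h'
      rw [← add_assoc]
      linarith
    have hm : (m + 1 : ℝ) ≠ 0 := by positivity
    have hjm : (j + m + 1 : ℝ) ≠ 0 := by positivity
    simp only [Uc, Uop]
    rw [X.filter_subset_eq_powersetCard hτ]
    push_cast
    apply mul_left_cancel₀ hm
    rw [← hsum]
    field_simp
    linear_combination (∑ σ ∈ τ.powersetCard (j + m), Uc X j m g σ) * hchoose

/-- The level functions of the sub-faces of `τ` sum to the iterated down operator at `τ`. -/
lemma sum_powerset_gLevel (X : WSC n d) (k : ℕ) (f : Cf n) {i : ℕ} {τ : Finset (Fin n)}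
    (hτ : τ ∈ X.faces i) :
    ∑ σ ∈ τ.powerset, gLevel X k f σ.card σ = Dc X k (k - i) f τ := by
  have hcard := X.card_mem i τ hτ
  have hlevel : ∀ j, ∑ σ ∈ τ.powersetCard j, gLevel X k f σ.card σ
      = ∑ σ ∈ τ.powersetCard j, gLevel X k f j σ := fun j =>
    sum_congr rfl fun σ hσ => by rw [(mem_powersetCard.1 hσ).2]
  have hself : τ.powersetCard i = {τ} := by rw [← hcard, powersetCard_self]
  rw [sum_powerset, hcard, sum_range_succ, hlevel i, hself, sum_singleton, gLevel, Pi.sub_apply,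
    sum_attach (range i)
      (fun j => (i.choose j : ℝ) • Uc X j (i - j) (gLevel X k f j)), Finset.sum_apply]
  have hsum : ∑ j ∈ range i, ((i.choose j : ℝ) • Uc X j (i - j) (gLevel X k f j)) τ
      = ∑ j ∈ range i, ∑ σ ∈ τ.powersetCard j, gLevel X k f σ.card σ := by
    refine sum_congr rfl fun j hj => ?_
    have hji : j + (i - j) = i := by have := mem_range.1 hj; omega
    have h := choose_mul_Uc X j (i - j) (gLevel X k f j) (τ := τ) (by rwa [hji])
    rw [hji] at h
    rw [hlevel j, ← h, Pi.smul_apply, smul_eq_mul]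
  rw [hsum]
  ring

/-- Möbius inversion on a powerset, as an upper bound. -/
lemma abs_le_two_pow_card_mul {α : Type*} [DecidableEq α] (h : Finset α → ℝ) (s : Finset α)
    (M : ℝ) (hM : ∀ t ⊆ s, |∑ u ∈ t.powerset, h u| ≤ M) : |h s| ≤ 2 ^ s.card * M := by
  induction s using Finset.induction_on generalizing h M with
  | empty => simpa using hM ∅ subset_rfl
  | insert a s ha ih =>
    have key := ih (fun u => h (insert a u)) (2 * M) fun t ht => by
      have h₁ := hM (insert a t) (insert_subset_insert a ht)
      have h₂ := hM t (ht.trans (subset_insert a s))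
      rw [sum_powerset_insert (fun hat => ha (ht hat))] at h₁
      rw [abs_le] at h₁ h₂ ⊢
      constructor <;> linarith
    rw [card_insert_of_notMem ha, pow_succ, mul_assoc]
    exact key

lemma sum_filter_superset_w (X : WSC n d) {j : ℕ} (hj : j < d) {τ : Finset (Fin n)}
    (hτ : τ ∈ X.faces j) :
    ∑ σ ∈ (X.faces (j + 1)).filter (fun σ => τ ⊆ σ), X.w (j + 1) σ = (j + 1) * X.w j τ := by
  rw [X.w_rec j hj τ hτ]
  field_simp

/-- Double counting of chains `τ ⊆ σ ⊆ ρ` with `σ` one level above `τ`. -/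
lemma sum_superset_sum_superset (X : WSC n d) {j k : ℕ} (φ : Cf n) {τ : Finset (Fin n)}
    (hτ : τ ∈ X.faces j) :
    ∑ σ ∈ (X.faces (j + 1)).filter (fun σ => τ ⊆ σ),
        ∑ ρ ∈ (X.faces k).filter (fun ρ => σ ⊆ ρ), φ ρ
      = ((k - j : ℕ) : ℝ) * ∑ ρ ∈ (X.faces k).filter (fun ρ => τ ⊆ ρ), φ ρ := by
  have hcard := X.card_mem j τ hτ
  rw [sum_comm' (t' := (X.faces k).filter (fun ρ => τ ⊆ ρ))
    (s' := fun ρ => (ρ.powersetCard (τ.card + 1)).filter (fun σ => τ ⊆ σ)), mul_sum]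
  · refine sum_congr rfl fun ρ hρ => ?_
    rw [mem_filter] at hρ
    rw [sum_const, card_filter_subset_powersetCard_succ hρ.2, X.card_mem k ρ hρ.1, hcard,
      nsmul_eq_mul]
  · intro σ ρ
    simp only [mem_powersetCard, mem_filter, hcard]
    constructor
    · rintro ⟨⟨hσ, hτσ⟩, hρ, hσρ⟩
      exact ⟨⟨⟨hσρ, X.card_mem _ σ hσ⟩, hτσ⟩, hρ, hτσ.trans hσρ⟩
    · rintro ⟨⟨⟨hσρ, hσ⟩, hτσ⟩, hρ, -⟩
      exact ⟨⟨X.mem_faces_of_subset hρ hσρ hσ, hτσ⟩, hρ, hσρ⟩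

/-- The numerator and the denominator of a link mean, up to a common factor. -/
lemma exists_sum_superset_eq (X : WSC n d) {k : ℕ} (hk : k ≤ d) (f : Cf n) (m : ℕ) (hm : m ≤ k) :
    ∃ c : ℝ, 0 < c ∧ ∀ τ ∈ X.faces (k - m),
      ∑ ρ ∈ (X.faces k).filter (fun ρ => τ ⊆ ρ), X.w k ρ = c * X.w (k - m) τ ∧
      ∑ ρ ∈ (X.faces k).filter (fun ρ => τ ⊆ ρ), X.w k ρ * f ρ
        = c * X.w (k - m) τ * Dc X k m f τ := by
  induction m with
  | zero =>
    refine ⟨1, one_pos, fun τ hτ => ?_⟩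
    have h : (X.faces k).filter (fun ρ => τ ⊆ ρ) = {τ} := by
      ext ρ
      rw [mem_filter, mem_singleton]
      constructor
      · rintro ⟨hρ, hτρ⟩
        exact (eq_of_subset_of_card_le hτρ
          (by rw [X.card_mem k ρ hρ, X.card_mem _ τ hτ, Nat.sub_zero])).symm
      · rintro rfl
        exact ⟨hτ, subset_rfl⟩
    simp [h, Dc]
  | succ m ih =>
    obtain ⟨c, hc, ih⟩ := ih (by omega)
    obtain ⟨j, hj⟩ : ∃ j, j = k - (m + 1) := ⟨_, rfl⟩
    have hjm : k - m = j + 1 := by omega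
    have hkj : k - j = m + 1 := by omega
    rw [hjm] at ih
    rw [← hj]
    refine ⟨c * (j + 1) / (m + 1), by positivity, fun τ hτ => ?_⟩
    have hw := sum_filter_superset_w X (by omega) hτ
    have hwpos := X.w_pos j τ hτ
    have h₁ := sum_superset_sum_superset X (k := k) (fun ρ => X.w k ρ) hτ
    have h₂ := sum_superset_sum_superset X (k := k) (fun ρ => X.w k ρ * f ρ) hτ
    rw [sum_congr rfl fun σ hσ => (ih σ (mem_filter.1 hσ).1).1, ← mul_sum, hw, hkj] at h₁
    rw [sum_congr rfl fun σ hσ => (ih σ (mem_filter.1 hσ).1).2, hkj] at h₂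
    simp only [mul_assoc] at h₂
    rw [← mul_sum] at h₂
    push_cast at h₁ h₂
    constructor
    · field_simp
      linarith
    · have hD : Dc X k (m + 1) f τ
          = (∑ σ ∈ (X.faces (j + 1)).filter (fun σ => τ ⊆ σ), X.w (j + 1) σ * Dc X k m f σ)
            / ((j + 1) * X.w j τ) := by
        rw [← hw, hj]
        rfl
      rw [hD]
      field_simp
      linarith

/-- The iterated down operator computes link means. -/
lemma Dc_eq_linkMean (X : WSC n d) {k : ℕ} (hk : k ≤ d) (f : Cf n) {i : ℕ} (hik : i ≤ k)
    {τ : Finset (Fin n)} (hτ : τ ∈ X.faces i) : Dc X k (k - i) f τ = linkMean X k τ f := by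
  obtain ⟨c, hc, h⟩ := exists_sum_superset_eq X hk f (k - i) (by omega)
  rw [show k - (k - i) = i by omega] at h
  have hw := X.w_pos i τ hτ
  rw [linkMean, (h τ hτ).1, (h τ hτ).2]
  field_simp

/-- A uniform bound at one level persists under the down operator. -/
lemma abs_Dop_le (X : WSC n d) {j : ℕ} (hj : j < d) {h : Cf n} {M : ℝ}
    (hM : ∀ σ ∈ X.faces (j + 1), |h σ| ≤ M) {τ : Finset (Fin n)} (hτ : τ ∈ X.faces j) :
    |Dop X j h τ| ≤ M := by
  have hw := sum_filter_superset_w X hj hτ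
  have hpos : 0 < ∑ σ ∈ (X.faces (j + 1)).filter (fun σ => τ ⊆ σ), X.w (j + 1) σ := by
    have := X.w_pos j τ hτ
    rw [hw]
    positivity
  rw [Dop, abs_div, abs_of_pos hpos, div_le_iff₀ hpos, mul_sum]
  refine (abs_sum_le_sum_abs _ _).trans (sum_le_sum fun σ hσ => ?_)
  rw [abs_mul, abs_of_nonneg (X.w_nonneg _ σ), mul_comm]
  exact mul_le_mul_of_nonneg_right (hM σ (mem_filter.1 hσ).1) (X.w_nonneg _ σ)

/-- A bound on the link means of `i`-faces holds for the faces below as well. -/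
lemma abs_Dc_le_of_le (X : WSC n d) {k : ℕ} (hk : k ≤ d) (f : Cf n) {i j : ℕ} (hik : i ≤ k)
    (hji : j ≤ i) {M : ℝ} (hM : ∀ σ ∈ X.faces i, |Dc X k (k - i) f σ| ≤ M)
    {τ : Finset (Fin n)} (hτ : τ ∈ X.faces j) : |Dc X k (k - j) f τ| ≤ M := by
  induction hji using Nat.decreasingInduction generalizing τ with
  | self => exact hM τ hτ
  | of_succ j hj ih =>
    rw [show k - j = (k - (j + 1)) + 1 by omega, Dc,
      show k - (k - (j + 1) + 1) = j by omega]
    exact abs_Dop_le X (by omega) (fun σ hσ => ih hσ) hτ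

/-- infinity norm of level functions of pseudorandom functions:
on a two-sided `γ`-local-spectral expander, if `f ∈ C_k` is `(ε,i)`-pseudorandom and
`E[f] ≤ ε‖f‖_∞`, then `‖g_i‖_∞ ≤ 2^i·ε·‖f‖_∞`. -/
theorem stmt12 (n d : ℕ) (X : WSC n d) (γ : ℝ) (hγ : 0 ≤ γ) (hX : IsLSE X γ)
    (k : ℕ) (hk : k ≤ d) (f : Cf n) (ε : ℝ) (hε : 0 ≤ ε) (i : ℕ) (hik : i ≤ k)
    (hpr : Pseudorandom X k ε i f) (hmean : EE X k f ≤ ε * normInf X k f) :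
    normInf X i (gLevel X k f i) ≤ (2:ℝ)^i * ε * normInf X k f := by
  obtain hempty | hne := isEmpty_or_nonempty {σ // σ ∈ X.faces i}
  · rw [normInf, Real.iSup_of_isEmpty]
    have : 0 ≤ normInf X k f := Real.iSup_nonneg fun _ => abs_nonneg _
    positivity
  · refine ciSup_le fun ⟨τ, hτ⟩ => ?_
    have hbound : ∀ σ ∈ X.faces i, |Dc X k (k - i) f σ| ≤ ε * normInf X k f := fun σ hσ => by
      rw [Dc_eq_linkMean X hk f hik hσ]
      exact (hpr σ hσ).1
    have hcard := X.card_mem i τ hτ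
    have key := abs_le_two_pow_card_mul (fun σ => gLevel X k f σ.card σ) τ (ε * normInf X k f)
      fun σ hσ => by
        have hface := X.mem_faces_of_subset hτ hσ rfl
        rw [sum_powerset_gLevel X k f hface]
        exact abs_Dc_le_of_le X hk f hik (hcard ▸ card_le_card hσ) hbound hface
    rw [hcard, ← mul_assoc] at key
    exact key
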